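/- arXiv:0903.4077 — 4 statements merged into one kernel-verified Lean document; each statement's English description precedes it below -/
import Mathlib

section
/- Let p be a prime, m ≥ 1 an integer, and k a finite field with p^m elements. Then there exists an element a ∈ k such that the family (σ^j(a))_{0 ≤ j ≤ m-1} is linearly independent over the prime field 𝔽_p (hence is an 𝔽_p-basis of k) and moreover ∑_{j=0}^{m-1} σ^j(a) = 1. -/
/-- A finite Galois extension has a normal basis generator of trace one. -/
theorem exists_linearIndependent_algEquiv_apply_trace_eq_one (K L : Type*) [Field K] [Field L]
    [Algebra K L] [FiniteDimensional K L] [IsGalois K L] :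
    ∃ x : L, LinearIndependent K (fun σ : Gal(L/K) ↦ σ x) ∧ Algebra.trace K L x = 1 := by
  obtain ⟨x, hx⟩ := exists_linearIndependent_algEquiv_apply K L
  have htr : Algebra.trace K L x ≠ 0 := fun h ↦ by
    have hsum : ∑ σ : Gal(L/K), (1 : K) • σ x = 0 := by
      simp_rw [one_smul, ← trace_eq_sum_automorphisms, h, map_zero]
    exact one_ne_zero (Fintype.linearIndependent_iff.mp hx (fun _ ↦ 1) hsum 1)
  refine ⟨(Algebra.trace K L x)⁻¹ • x, ?_, by simp [htr]⟩
  simp_rw [map_smul]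
  exact hx.units_smul fun _ ↦ Units.mk0 _ (inv_ne_zero htr)

/-- **Normal basis with trace one for finite fields.**
For a finite field `k` with `p ^ m` elements there is an element `a ∈ k` such that the
Frobenius orbit `σ^j(a) = a^(p^j)`, `0 ≤ j ≤ m-1`, is linearly independent over the prime
field `𝔽_p = ZMod p`, and moreover `∑_{j=0}^{m-1} σ^j(a) = 1`. -/
theorem stmt0 (p m : ℕ) (hp : p.Prime) (hm : 1 ≤ m)
    (k : Type*) [Field k] [Fintype k] [CharP k p]
    (hcard : Fintype.card k = p ^ m) :
    letI : Algebra (ZMod p) k := ZMod.algebra k p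
    ∃ a : k, LinearIndependent (ZMod p) (fun j : Fin m => a ^ p ^ (j : ℕ)) ∧
      (∑ j : Fin m, a ^ p ^ (j : ℕ)) = 1 := by
  let : Algebra (ZMod p) k := ZMod.algebra k p
  have : Fact p.Prime := ⟨hp⟩
  have hfin : Module.finrank (ZMod p) k = m := by
    have h := Module.card_eq_pow_finrank (K := ZMod p) (V := k)
    rw [hcard, ZMod.card] at h
    exact (Nat.pow_right_injective hp.two_le h).symm
  obtain ⟨a, hli, htr⟩ := exists_linearIndependent_algEquiv_apply_trace_eq_one (ZMod p) k
  subst hfin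
  refine ⟨a, ?_, ?_⟩
  · have h := hli.comp _
      (FiniteField.bijective_frobeniusAlgEquivOfAlgebraic_pow (ZMod p) k).injective
    simpa only [Function.comp_def, AlgEquiv.coe_pow,
      FiniteField.coe_frobeniusAlgEquivOfAlgebraic_iterate, ZMod.card] using h
  · have h := FiniteField.algebraMap_trace_eq_sum_pow (ZMod p) k a
    rw [htr, map_one, Nat.card_zmod, Finset.sum_range] at h
    exact h.symm
end

section
/- Let p be a prime, m ≥ 1 an integer, k a finite field with p^m elements, and a ∈ k an element such that the family (σ^j(a))_{0 ≤ j ≤ m-1} is linearly independent over the prime field 𝔽_p and ∑_{j=0}^{m-1} σ^j(a) = 1. Define a sequence (a_i)_{i ≥ 1} in k by a_1 = a and a_{i+1} = σ(a_i) + a. Then the elements a_1, a_2, …, a_{pm} are pairwise distinct (so the set {a_j : 1 ≤ j ≤ pm} has exactly pm elements). -/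
open Finset in
/-- If `a` has absolute trace `1`, the partial sums of its Frobenius orbit over a range of length
`q * m + r` are `q` plus the partial sum of length `r`. -/
lemma sum_frobenius_orbit_mul_add {k : Type*} [Field k] {p m : ℕ} {a : k}
    (hfix : a ^ p ^ m = a) (hsum : ∑ l ∈ range m, a ^ p ^ l = 1) (q r : ℕ) :
    ∑ l ∈ range (q * m + r), a ^ p ^ l = q + ∑ l ∈ range r, a ^ p ^ l := by
  induction q with
  | zero => simp
  | succ q ih =>
    have h : (q + 1) * m + r = m + (q * m + r) := by ring
    have hshift (l : ℕ) : a ^ p ^ (m + l) = a ^ p ^ l := by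
      rw [pow_add, pow_mul, hfix]
    rw [h, sum_range_add, hsum]
    simp only [hshift]
    rw [ih]
    push_cast
    ring

open Finset in
/-- If the Frobenius orbit of `a` is linearly independent with sum `1`, then the partial sums of
the orbit of positive length less than `p * m` do not vanish. -/
lemma sum_frobenius_orbit_ne_zero {k : Type*} [Field k] {p m : ℕ} [Fact p.Prime]
    [Algebra (ZMod p) k] {a : k} (hfix : a ^ p ^ m = a)
    (hli : LinearIndependent (ZMod p) (fun j : Fin m => a ^ p ^ (j : ℕ)))
    (hsum : ∑ j : Fin m, a ^ p ^ (j : ℕ) = 1) {d : ℕ} (hd : 0 < d) (hdm : d < p * m) :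
    ∑ l ∈ range d, a ^ p ^ l ≠ 0 := by
  intro h0
  have hm : 0 < m := Nat.pos_of_ne_zero (by rintro rfl; simp at hdm)
  have hr : d % m < m := Nat.mod_lt _ hm
  have hq : d / m < p := (Nat.div_lt_iff_lt_mul hm).2 hdm
  have hdiv : d / m * m + d % m = d := Nat.div_add_mod' d m
  rw [← hdiv, sum_frobenius_orbit_mul_add hfix
    (by rw [← hsum, Fin.sum_univ_eq_sum_range (fun l => a ^ p ^ l)])] at h0
  have hpart : ∑ l ∈ range (d % m), a ^ p ^ l
      = ∑ j : Fin m, if (j : ℕ) < d % m then a ^ p ^ (j : ℕ) else 0 := by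
    rw [Fin.sum_univ_eq_sum_range (fun l => if l < d % m then a ^ p ^ l else 0),
      ← sum_filter]
    congr 1
    ext l
    simp only [mem_range, mem_filter]
    omega
  have hcoef := Fintype.linearIndependent_iff.1 hli
    (fun j => ((d / m : ℕ) : ZMod p) + if (j : ℕ) < d % m then 1 else 0) (by
      simp only [add_smul, ite_smul, one_smul, zero_smul, sum_add_distrib]
      rw [← smul_sum, hsum, ← hpart, Algebra.smul_def, map_natCast, mul_one, h0])
  have hlast := hcoef ⟨m - 1, by omega⟩
  have hlt : ¬ m - 1 < d % m := by omega
  simp only [hlt, if_false, add_zero] at hlast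
  have hq0 : d / m = 0 :=
    Nat.eq_zero_of_dvd_of_lt ((ZMod.natCast_eq_zero_iff _ _).1 hlast) hq
  have hfirst := hcoef ⟨0, hm⟩
  have hpos : 0 < d % m := by
    rw [hq0] at hdiv
    omega
  simp [hq0, hpos] at hfirst

/-- Let `k` be a finite field with `p ^ m` elements and `a ∈ k` such that the Frobenius
orbit `σ^j(a) = a^(p^j)`, `0 ≤ j ≤ m-1`, is linearly independent over `𝔽_p` and
`∑_{j=0}^{m-1} σ^j(a) = 1`.  For the sequence `a_1 = a`, `a_{i+1} = σ(a_i) + a`,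
the elements `a_1, …, a_{pm}` are pairwise distinct. -/
theorem stmt4 (p m : ℕ) (hp : p.Prime) (hm : 1 ≤ m)
    (k : Type*) [Field k] [Fintype k] [CharP k p]
    (hcard : Fintype.card k = p ^ m) (a : k)
    (hli : letI : Algebra (ZMod p) k := ZMod.algebra k p
      LinearIndependent (ZMod p) (fun j : Fin m => a ^ p ^ (j : ℕ)))
    (hsum : (∑ j : Fin m, a ^ p ^ (j : ℕ)) = 1)
    (seq : ℕ → k) (hseq1 : seq 1 = a)
    (hseqstep : ∀ i, 1 ≤ i → seq (i + 1) = (seq i) ^ p + a) :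
    ∀ i j, 1 ≤ i → i ≤ p * m → 1 ≤ j → j ≤ p * m → seq i = seq j → i = j := by
  have : Fact p.Prime := ⟨hp⟩
  let _ : Algebra (ZMod p) k := ZMod.algebra k p
  have hfix : a ^ p ^ m = a := by rw [← hcard, FiniteField.pow_card]
  have hseq (i : ℕ) (hi : 1 ≤ i) : seq i = ∑ l ∈ Finset.range i, a ^ p ^ l := by
    induction i, hi using Nat.le_induction with
    | base => simp [hseq1]
    | succ i hi ih =>
      rw [hseqstep i hi, ih, sum_pow_char, Finset.sum_range_succ', pow_zero, pow_one]
      simp only [pow_succ, pow_mul]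
  have hlt (i j : ℕ) (hi : 1 ≤ i) (hij : i < j) (hj : j ≤ p * m) : seq i ≠ seq j := by
    intro h
    obtain ⟨d, rfl⟩ := Nat.exists_eq_add_of_lt hij
    rw [hseq i hi, hseq _ (by omega), add_assoc, Finset.sum_range_add, left_eq_add] at h
    refine sum_frobenius_orbit_ne_zero hfix hli hsum (d := d + 1) (by omega) (by omega) ?_
    refine eq_zero_of_pow_eq_zero (n := p ^ i) ?_
    rw [sum_pow_char_pow, ← h]
    refine Finset.sum_congr rfl fun l _ => ?_
    rw [← pow_mul, ← pow_add, add_comm]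
  intro i j hi hi' hj hj' h
  rcases lt_trichotomy i j with hij | hij | hij
  · exact absurd h (hlt i j hi hij hj')
  · exact hij
  · exact absurd h.symm (hlt j i hj hij hi')
end

section
/- Let p be a prime, m ≥ 1 an integer, k a finite field with p^m elements, and a ∈ k an element with ∑_{j=0}^{m-1} σ^j(a) = 1. Let φ : k[X] → k[X] be the ring endomorphism of the polynomial ring k[X] which maps each coefficient by the Frobenius σ (c ↦ c^p) and sends X to X + a. Then φ^{pm} is the identity map of k[X], and φ^i is not the identity for every i with 1 ≤ i < pm; in other words φ is a ring automorphism of k[X] of order exactly pm. -/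
open Polynomial in
/-- The number of fixed points of an iterate of Frobenius bounds the field size, so
an iterate `c ↦ c ^ p ^ i` is trivial only when `m ∣ i`. -/
theorem dvd_of_forall_pow_eq_self {k : Type*} [Field k] [Fintype k] {p m : ℕ} (hp : 1 < p)
    (hm : 1 ≤ m) (hcard : Fintype.card k = p ^ m) {i : ℕ} (h : ∀ c : k, c ^ p ^ i = c) :
    m ∣ i := by
  classical
  by_contra hdvd
  have hr : i % m ≠ 0 := fun h0 => hdvd (Nat.dvd_of_mod_eq_zero h0)
  have hfix : ∀ c : k, c ^ p ^ (i % m) = c := fun c => by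
    have hc := h c
    rw [← Nat.div_add_mod i m, pow_add, pow_mul, pow_mul, ← hcard,
      FiniteField.pow_card_pow] at hc
    exact hc
  have hlt : 1 < p ^ (i % m) := Nat.one_lt_pow hr hp
  have hle : Fintype.card k ≤ p ^ (i % m) := by
    rw [← FiniteField.X_pow_card_sub_X_natDegree_eq k hlt]
    exact card_le_degree_of_subset_roots (Z := Finset.univ) fun c _ => by
      rw [mem_roots (FiniteField.X_pow_card_sub_X_ne_zero k hlt)]
      simp [hfix c]
  rw [hcard] at hle
  exact absurd ((Nat.pow_le_pow_iff_right hp).mp hle) (Nat.mod_lt i hm).not_ge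

/-- The sum of Frobenius conjugates over `t` full periods is `t` times the trace. -/
theorem sum_range_mul_pow_pow {k : Type*} [Field k] [Fintype k] {p m : ℕ}
    (hcard : Fintype.card k = p ^ m) (a : k) (t : ℕ) :
    ∑ j ∈ Finset.range (m * t), a ^ p ^ j = t * ∑ j ∈ Finset.range m, a ^ p ^ j := by
  induction t with
  | zero => simp
  | succ t ih =>
    rw [Nat.mul_succ, Finset.sum_range_add, ih, Nat.cast_succ, add_mul, one_mul]
    congr 1
    refine Finset.sum_congr rfl fun j _ => ?_
    rw [pow_add, pow_mul, pow_mul p, ← hcard, FiniteField.pow_card_pow]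

open Polynomial in
/-- Iterates of the twisted translation `X ↦ X + a`, in closed form. -/
theorem iterate_frobenius_translate {k : Type*} [Field k] {p : ℕ} [Fact p.Prime] [CharP k p]
    {a : k} {φ : k[X] →+* k[X]}
    (hφ : ∀ f : k[X], φ f = (f.map (frobenius k p)).comp (X + C a)) (i : ℕ) (f : k[X]) :
    φ^[i] f = (f.map (iterateFrobenius k p i)).comp
      (X + C (∑ j ∈ Finset.range i, a ^ p ^ j)) := by
  induction i with
  | zero =>
    have h0 : iterateFrobenius k p 0 = RingHom.id k := by ext; simp
    simp [h0]
  | succ i ih =>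
    have hfrob : (frobenius k p).comp (iterateFrobenius k p i) = iterateFrobenius k p (i + 1) := by
      ext c
      simp [iterateFrobenius_def, frobenius_def, pow_succ, pow_mul]
    rw [Function.iterate_succ_apply', ih, hφ, Polynomial.map_comp, Polynomial.map_map, hfrob,
      comp_assoc]
    congr 1
    simp only [Polynomial.map_add, map_X, map_C, add_comp, X_comp, C_comp, add_assoc, ← C_add]
    rw [Finset.sum_range_succ', map_sum]
    simp [frobenius_def, pow_succ, pow_mul, add_comm]


/-- Let `k` be a finite field with `p ^ m` elements and `a ∈ k` with
`∑_{j=0}^{m-1} σ^j(a) = 1` (σ the Frobenius `c ↦ c^p`).  Let `φ : k[X] → k[X]` be the ring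
endomorphism applying `σ` to the coefficients and substituting `X ↦ X + a`.
Then `φ^(pm) = id` while `φ^i ≠ id` for `1 ≤ i < pm`; i.e. `φ` is a ring automorphism
of `k[X]` of order exactly `pm`. -/
theorem stmt7 (p m : ℕ) [Fact p.Prime] (hm : 1 ≤ m)
    (k : Type*) [Field k] [Fintype k] [CharP k p]
    (hcard : Fintype.card k = p ^ m) (a : k)
    (hsum : (∑ j : Fin m, a ^ p ^ (j : ℕ)) = 1)
    (φ : Polynomial k →+* Polynomial k)
    (hφ : ∀ f : Polynomial k,
      φ f = (f.map (frobenius k p)).comp (Polynomial.X + Polynomial.C a)) :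
    (⇑φ)^[p * m] = id ∧ ∀ i, 1 ≤ i → i < p * m → (⇑φ)^[i] ≠ id := by
  have hp : p.Prime := Fact.out
  rw [Fin.sum_univ_eq_sum_range fun j => a ^ p ^ j] at hsum
  have hs (t : ℕ) : ∑ j ∈ Finset.range (m * t), a ^ p ^ j = (t : k) := by
    rw [sum_range_mul_pow_pow hcard, hsum, mul_one]
  have hiter := iterate_frobenius_translate hφ
  refine ⟨?_, fun i hi hlt hid => ?_⟩
  · have hfrob : iterateFrobenius k p (m * p) = RingHom.id k := by
      ext c
      rw [iterateFrobenius_def, pow_mul, ← hcard, FiniteField.pow_card_pow, RingHom.id_apply]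
    funext f
    rw [mul_comm, hiter, hs, hfrob]
    simp
  · obtain ⟨t, rfl⟩ := dvd_of_forall_pow_eq_self hp.one_lt hm hcard (i := i) fun c => by
      have h := hiter i (Polynomial.C c)
      rw [hid, Polynomial.map_C, Polynomial.C_comp, iterateFrobenius_def] at h
      exact (Polynomial.C_injective h).symm
    have ht : (t : k) = 0 := by
      have h := congrArg (Polynomial.eval 0) (hiter (m * t) Polynomial.X)
      rw [hid, hs] at h
      simpa [eq_comm] using h
    have hdvd : p * m ∣ m * t := by
      rw [mul_comm p]
      exact mul_dvd_mul_left m ((CharP.cast_eq_zero_iff k p t).mp ht)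
    exact absurd (Nat.le_of_dvd hi hdvd) hlt.not_ge
end

section
/- Let p be a prime, m ≥ 1 an integer, k a finite field with p^m elements, and a ∈ k an element with ∑_{j=0}^{m-1} σ^j(a) = 1. Define a sequence (a_i)_{i ≥ 1} in k by a_1 = a and a_{i+1} = σ(a_i) + a, and let φ : k[X] → k[X] be the ring endomorphism of k[X] which maps each coefficient by the Frobenius σ and sends X to X + a. Then the polynomial P = ∏_{i=1}^{pm} (X + a_i) satisfies φ(P) = P; moreover P is monic of degree pm. -/
/-- A sequence satisfying `u (n + 1) = (u n) ^ p + a` with `u 1 = a` consists of the partial sums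
of the Frobenius orbit of `a`. -/
theorem eq_sum_pow_of_frobenius_rec {k : Type*} [CommRing k] (p : ℕ) [Fact p.Prime] [CharP k p]
    (a : k) (u : ℕ → k) (h1 : u 1 = a) (hstep : ∀ i, 1 ≤ i → u (i + 1) = u i ^ p + a) (n : ℕ) :
    u (n + 1) = ∑ j ∈ Finset.range (n + 1), a ^ p ^ j := by
  induction n with
  | zero => simp [h1]
  | succ n ih =>
    rw [hstep _ (Nat.le_add_left 1 n), ih, sum_pow_char, Finset.sum_range_succ' _ (n + 1)]
    simp [pow_succ, pow_mul]

/-- If `a` has trace `1` and `k` has `p ^ m` elements, the partial sums of the Frobenius orbit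
increase by `t` over `m * t` steps. -/
theorem sum_range_pow_add_mul {k : Type*} [Field k] [Fintype k] {p m : ℕ}
    (hcard : Fintype.card k = p ^ m) (a : k)
    (hsum : ∑ j ∈ Finset.range m, a ^ p ^ j = 1) (n t : ℕ) :
    ∑ j ∈ Finset.range (m * t + n), a ^ p ^ j = ∑ j ∈ Finset.range n, a ^ p ^ j + t := by
  induction t with
  | zero => simp
  | succ t ih =>
    have hpow (j : ℕ) : a ^ p ^ (m + j) = a ^ p ^ j := by
      rw [pow_add, pow_mul, ← hcard, FiniteField.pow_card]
    rw [show m * (t + 1) + n = m + (m * t + n) by ring, Finset.sum_range_add, hsum]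
    simp only [hpow, ih]
    push_cast
    ring

/-- Let `k` be a finite field with `p ^ m` elements and `a ∈ k` with
`∑_{j=0}^{m-1} σ^j(a) = 1` (σ the Frobenius `c ↦ c^p`).  Let `a_1 = a`,
`a_{i+1} = σ(a_i) + a`, and let `φ : k[X] → k[X]` be the ring endomorphism applying `σ`
to the coefficients and substituting `X ↦ X + a`.  Then the polynomial
`P = ∏_{i=1}^{pm} (X + a_i)` satisfies `φ P = P`, and `P` is monic of degree `pm`. -/
theorem stmt8 (p m : ℕ) [Fact p.Prime] (hm : 1 ≤ m)
    (k : Type*) [Field k] [Fintype k] [CharP k p]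
    (hcard : Fintype.card k = p ^ m) (a : k)
    (hsum : (∑ j : Fin m, a ^ p ^ (j : ℕ)) = 1)
    (seq : ℕ → k) (hseq1 : seq 1 = a)
    (hseqstep : ∀ i, 1 ≤ i → seq (i + 1) = (seq i) ^ p + a)
    (φ : Polynomial k →+* Polynomial k)
    (hφ : ∀ f : Polynomial k,
      φ f = (f.map (frobenius k p)).comp (Polynomial.X + Polynomial.C a))
    (P : Polynomial k)
    (hP : P = ∏ i ∈ Finset.Icc 1 (p * m), (Polynomial.X + Polynomial.C (seq i))) :
    φ P = P ∧ P.Monic ∧ P.natDegree = p * m := by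
  have hsum' : ∑ j ∈ Finset.range m, a ^ p ^ j = 1 := by
    rw [← hsum, Finset.sum_range]
  have hperiod : seq (p * m + 1) = seq 1 := by
    have h := sum_range_pow_add_mul hcard a hsum' 1 p
    rw [mul_comm m p, CharP.cast_eq_zero, add_zero] at h
    rw [eq_sum_pow_of_frobenius_rec p a seq hseq1 hseqstep, h, hseq1]
    simp
  have hP' : P = ∏ i ∈ Finset.range (p * m), (Polynomial.X + Polynomial.C (seq (i + 1))) := by
    rw [hP, Finset.range_eq_Ico,
      Finset.prod_Ico_add' (fun i => Polynomial.X + Polynomial.C (seq i)) 0 (p * m) 1]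
    rfl
  have hφX (i : ℕ) : φ (Polynomial.X + Polynomial.C (seq (i + 1))) =
      Polynomial.X + Polynomial.C (seq (i + 1 + 1)) := by
    rw [hφ, hseqstep _ (Nat.le_add_left 1 i)]
    simp [frobenius_def]
    ring
  refine ⟨?_, ?_, ?_⟩
  · rw [hP', map_prod]
    simp only [hφX]
    have h := Finset.prod_range_succ'
      (fun i => Polynomial.X + Polynomial.C (seq (i + 1))) (p * m)
    rw [Finset.prod_range_succ, hperiod, zero_add] at h
    exact (mul_right_cancel₀ (Polynomial.X_add_C_ne_zero _) h).symm
  · rw [hP]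
    exact Polynomial.monic_prod_of_monic _ _ fun i _ => Polynomial.monic_X_add_C _
  · rw [hP, Polynomial.natDegree_prod_of_monic _ _ fun i _ => Polynomial.monic_X_add_C _]
    simp
end
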